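/- arXiv:2202.08007 — 2 statements merged into one kernel-verified Lean document; each statement's English description precedes it below -/
import Mathlib

section
/- Peeling version of the Freedman inequality: for ε > 0, v > w > 0, α > 0 and any t, P(H•M^a_t ≥ √(2α(1+ε)⟨H•M^a⟩_t) + αb/3, w ≤ ⟨H•M^a⟩_t ≤ v) ≤ ⌈log(v/w + 1)/log(1+ε)⌉ e^{−α} P(⟨H•M^a⟩_t > 0). -/
open MeasureTheory Finset

/-- The pointwise bound behind Bernstein-type inequalities. -/
lemma exp_le_one_add_add_sq_div {u B : ℝ} (hu : |u| ≤ B) (hB : B < 3) :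
    Real.exp u ≤ 1 + u + u ^ 2 / (2 * (1 - B / 3)) := by
  have hB0 : 0 ≤ B := (abs_nonneg u).trans hu
  have h1 : HasSum (fun n : ℕ => u ^ n / (n.factorial : ℝ)) (Real.exp u) := by
    simpa [Real.exp_eq_exp_ℝ] using NormedSpace.expSeries_div_hasSum_exp (𝔸 := ℝ) u
  have h2 := (hasSum_nat_add_iff' 2).2 h1
  have h3 := (hasSum_geometric_of_lt_one (r := B / 3) (by positivity)
    (by linarith)).mul_left (u ^ 2 / 2)
  have h4 := hasSum_le (fun n => ?_) h2 h3
  · simp only [Finset.sum_range_succ, Finset.sum_range_zero, Nat.factorial] at h4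
    have h5 : u ^ 2 / (2 * (1 - B / 3)) = u ^ 2 / 2 * (1 - B / 3)⁻¹ := by
      rw [← div_div, div_eq_mul_inv (u ^ 2 / 2)]
    rw [h5]
    norm_num at h4 ⊢
    linarith
  · have hf : (2 * 3 ^ n : ℝ) ≤ ((n + 2).factorial : ℝ) := by
      have := Nat.factorial_mul_pow_le_factorial (m := 2) (n := n)
      rw [add_comm 2 n] at this
      exact_mod_cast this
    calc u ^ (n + 2) / ((n + 2).factorial : ℝ)
        ≤ |u| ^ (n + 2) / ((n + 2).factorial : ℝ) := by
          have : u ^ (n + 2) ≤ |u| ^ (n + 2) := (le_abs_self _).trans (abs_pow u _).le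
          gcongr
      _ ≤ |u| ^ (n + 2) / (2 * 3 ^ n) := by gcongr
      _ = u ^ 2 / 2 * (|u| / 3) ^ n := by
          rw [pow_add, sq_abs, div_pow]; field_simp
      _ ≤ u ^ 2 / 2 * (B / 3) ^ n := by gcongr

/-- `I n` is a Bernoulli variable, revealed at time `n + 1`, with conditional mean `q n` given
`ℱ n`, and `h` is a predictable weight bounded by `b`. -/
structure IsBernoulliTransform {Ω : Type*} {m0 : MeasurableSpace Ω} (μ : Measure Ω)
    (ℱ : Filtration ℕ m0) (I q h : ℕ → Ω → ℝ) (b : ℝ) : Prop where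
  stronglyMeasurable_I : ∀ n, StronglyMeasurable[ℱ (n + 1)] (I n)
  I_eq : ∀ n ω, I n ω = 0 ∨ I n ω = 1
  stronglyMeasurable_q : ∀ n, StronglyMeasurable[ℱ n] (q n)
  q_nonneg : ∀ n ω, 0 ≤ q n ω
  q_le_one : ∀ n ω, q n ω ≤ 1
  stronglyMeasurable_h : ∀ n, StronglyMeasurable[ℱ n] (h n)
  abs_h_le : ∀ n ω, |h n ω| ≤ b
  condExp_I : ∀ n, μ[I n | ℱ n] =ᵐ[μ] q n

/-- The martingale transform of the centered Bernoulli variables. -/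
def bernoulliTransform {Ω : Type*} (I q h : ℕ → Ω → ℝ) (n : ℕ) (ω : Ω) : ℝ :=
  ∑ i ∈ range n, h i ω * (I i ω - q i ω)

/-- The predictable quadratic variation of `bernoulliTransform`. -/
def bernoulliVariation {Ω : Type*} (q h : ℕ → Ω → ℝ) (n : ℕ) (ω : Ω) : ℝ :=
  ∑ i ∈ range n, h i ω ^ 2 * q i ω * (1 - q i ω)

namespace IsBernoulliTransform

variable {Ω : Type*} {m0 : MeasurableSpace Ω} {μ : Measure Ω}
  {ℱ : Filtration ℕ m0} {I q h : ℕ → Ω → ℝ} {b : ℝ}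

lemma abs_sub_le_one (hB : IsBernoulliTransform μ ℱ I q h b) (n : ℕ) (ω : Ω) :
    |I n ω - q n ω| ≤ 1 := by
  have h0 := hB.q_nonneg n ω
  have h1 := hB.q_le_one n ω
  rw [abs_le]
  rcases hB.I_eq n ω with h | h <;> rw [h] <;> constructor <;> linarith

lemma variation_term_nonneg (hB : IsBernoulliTransform μ ℱ I q h b) (n : ℕ) (ω : Ω) :
    0 ≤ h n ω ^ 2 * q n ω * (1 - q n ω) :=
  mul_nonneg (mul_nonneg (sq_nonneg _) (hB.q_nonneg n ω)) (by linarith [hB.q_le_one n ω])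

lemma variation_nonneg (hB : IsBernoulliTransform μ ℱ I q h b) (n : ℕ) (ω : Ω) :
    0 ≤ bernoulliVariation q h n ω :=
  Finset.sum_nonneg fun i _ => hB.variation_term_nonneg i ω

lemma stronglyMeasurable_transform (hB : IsBernoulliTransform μ ℱ I q h b) (n : ℕ) :
    StronglyMeasurable[ℱ n] (bernoulliTransform I q h n) := by
  refine Finset.stronglyMeasurable_fun_sum _ fun i hi => ?_
  have hi' : i + 1 ≤ n := Finset.mem_range.1 hi
  have hin : i ≤ n := by omega
  exact ((hB.stronglyMeasurable_h i).mono (ℱ.mono hin)).mul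
    (((hB.stronglyMeasurable_I i).mono (ℱ.mono hi')).sub
      ((hB.stronglyMeasurable_q i).mono (ℱ.mono hin)))

lemma stronglyMeasurable_variation_term (hB : IsBernoulliTransform μ ℱ I q h b) (n : ℕ) :
    StronglyMeasurable[ℱ n] fun ω => h n ω ^ 2 * q n ω * (1 - q n ω) :=
  (((hB.stronglyMeasurable_h n).pow 2).mul (hB.stronglyMeasurable_q n)).mul
    (stronglyMeasurable_const.sub (hB.stronglyMeasurable_q n))

lemma stronglyMeasurable_variation (hB : IsBernoulliTransform μ ℱ I q h b) (n : ℕ) :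
    StronglyMeasurable[ℱ n] (bernoulliVariation q h n) :=
  Finset.stronglyMeasurable_fun_sum _ fun i hi =>
    (hB.stronglyMeasurable_variation_term i).mono (ℱ.mono (Finset.mem_range.1 hi).le)

lemma abs_transform_le (hB : IsBernoulliTransform μ ℱ I q h b) (n : ℕ) (ω : Ω) :
    |bernoulliTransform I q h n ω| ≤ n * b := by
  refine (Finset.abs_sum_le_sum_abs _ _).trans ?_
  refine (Finset.sum_le_card_nsmul _ _ b fun i _ => ?_).trans_eq (by simp)
  rw [abs_mul]
  exact (mul_le_of_le_one_right (abs_nonneg _) (hB.abs_sub_le_one i ω)).trans (hB.abs_h_le i ω)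

lemma stronglyMeasurable_exp (hB : IsBernoulliTransform μ ℱ I q h b) (l g : ℝ) (n : ℕ) :
    StronglyMeasurable[ℱ n] fun ω =>
      Real.exp (l * bernoulliTransform I q h n ω - g * bernoulliVariation q h n ω) :=
  Real.continuous_exp.comp_stronglyMeasurable
    (((hB.stronglyMeasurable_transform n).const_mul l).sub
      ((hB.stronglyMeasurable_variation n).const_mul g))

lemma exp_le (hB : IsBernoulliTransform μ ℱ I q h b) {l g : ℝ} (hl : 0 ≤ l) (hg : 0 ≤ g)
    (n : ℕ) (ω : Ω) :
    Real.exp (l * bernoulliTransform I q h n ω - g * bernoulliVariation q h n ω)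
      ≤ Real.exp (l * (n * b)) := by
  have h1 := mul_le_mul_of_nonneg_left (le_of_abs_le (hB.abs_transform_le n ω)) hl
  have h2 := mul_nonneg hg (hB.variation_nonneg n ω)
  exact Real.exp_le_exp.2 (by linarith)

/-- One step of the exponential supermartingale, up to a centered term. -/
lemma exp_succ_le (hB : IsBernoulliTransform μ ℱ I q h b) {l : ℝ} (hl : 0 ≤ l)
    (hlb : l * b < 3) {g : ℝ} (hg : g = l ^ 2 / (2 * (1 - l * b / 3))) (n : ℕ) (ω : Ω) :
    Real.exp (l * bernoulliTransform I q h (n + 1) ω - g * bernoulliVariation q h (n + 1) ω)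
      ≤ Real.exp (l * bernoulliTransform I q h n ω - g * bernoulliVariation q h n ω)
        + Real.exp (l * bernoulliTransform I q h n ω - g * bernoulliVariation q h (n + 1) ω)
          * (l * h n ω + g * h n ω ^ 2 * (1 - 2 * q n ω)) * (I n ω - q n ω) := by
  set x := h n ω * (I n ω - q n ω) with hx
  set s := h n ω ^ 2 * q n ω * (1 - q n ω) with hs
  set y := l * bernoulliTransform I q h n ω - g * bernoulliVariation q h n ω with hy
  have hM : bernoulliTransform I q h (n + 1) ω = bernoulliTransform I q h n ω + x := by
    simp [bernoulliTransform, Finset.sum_range_succ, hx]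
  have hV : bernoulliVariation q h (n + 1) ω = bernoulliVariation q h n ω + s := by
    simp [bernoulliVariation, Finset.sum_range_succ, hs]
  have hxb : |l * x| ≤ l * b := by
    rw [abs_mul, abs_of_nonneg hl, hx, abs_mul]
    gcongr
    exact (mul_le_of_le_one_right (abs_nonneg _) (hB.abs_sub_le_one n ω)).trans
      (hB.abs_h_le n ω)
  have hexp : Real.exp (l * x) ≤ 1 + l * x + g * x ^ 2 := by
    refine (exp_le_one_add_add_sq_div hxb hlb).trans_eq ?_
    rw [hg]; ring
  have hsq : x ^ 2 = s + h n ω ^ 2 * (1 - 2 * q n ω) * (I n ω - q n ω) := by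
    rcases hB.I_eq n ω with h | h <;> rw [hx, hs, h] <;> ring
  have hgs : 1 + g * s ≤ Real.exp (g * s) := by linarith [Real.add_one_le_exp (g * s)]
  have e1 : l * bernoulliTransform I q h (n + 1) ω - g * bernoulliVariation q h (n + 1) ω
      = (y - g * s) + l * x := by rw [hM, hV, hy]; ring
  have e2 : l * bernoulliTransform I q h n ω - g * bernoulliVariation q h (n + 1) ω
      = y - g * s := by rw [hV, hy]; ring
  rw [e1, e2, Real.exp_add]
  calc Real.exp (y - g * s) * Real.exp (l * x)
      ≤ Real.exp (y - g * s) * (1 + l * x + g * x ^ 2) := by gcongr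
    _ = Real.exp (y - g * s) * (1 + g * s) + Real.exp (y - g * s)
          * (l * h n ω + g * h n ω ^ 2 * (1 - 2 * q n ω)) * (I n ω - q n ω) := by
        rw [hsq, hx]; ring
    _ ≤ Real.exp (y - g * s) * Real.exp (g * s) + Real.exp (y - g * s)
          * (l * h n ω + g * h n ω ^ 2 * (1 - 2 * q n ω)) * (I n ω - q n ω) := by gcongr
    _ = _ := by rw [← Real.exp_add, sub_add_cancel]

variable [IsProbabilityMeasure μ]

lemma integrable_of_bound {f : Ω → ℝ} (hf : StronglyMeasurable f) {C : ℝ}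
    (hC : ∀ ω, |f ω| ≤ C) : Integrable f μ :=
  Integrable.of_bound hf.aestronglyMeasurable C (ae_of_all _ hC)

lemma integrable_I (hB : IsBernoulliTransform μ ℱ I q h b) (n : ℕ) : Integrable (I n) μ :=
  integrable_of_bound ((hB.stronglyMeasurable_I n).mono (ℱ.le _)) (C := 1) fun ω => by
    rcases hB.I_eq n ω with h | h <;> simp [h]

lemma integrable_q (hB : IsBernoulliTransform μ ℱ I q h b) (n : ℕ) : Integrable (q n) μ :=
  integrable_of_bound ((hB.stronglyMeasurable_q n).mono (ℱ.le _)) (C := 1) fun ω => by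
    rw [abs_of_nonneg (hB.q_nonneg n ω)]; exact hB.q_le_one n ω

lemma integrable_mul_sub (hB : IsBernoulliTransform μ ℱ I q h b) (n : ℕ) {G : Ω → ℝ}
    (hG : StronglyMeasurable[ℱ n] G) {C : ℝ} (hC : ∀ ω, |G ω| ≤ C) :
    Integrable (fun ω => G ω * (I n ω - q n ω)) μ :=
  ((hB.integrable_I n).sub (hB.integrable_q n)).bdd_mul
    (hG.mono (ℱ.le n)).aestronglyMeasurable (c := C) (ae_of_all _ hC)

/-- Centered increments are orthogonal to bounded functions of the past. -/
lemma integral_mul_sub (hB : IsBernoulliTransform μ ℱ I q h b) (n : ℕ) {G : Ω → ℝ}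
    (hG : StronglyMeasurable[ℱ n] G) {C : ℝ} (hC : ∀ ω, |G ω| ≤ C) :
    ∫ ω, G ω * (I n ω - q n ω) ∂μ = 0 := by
  have hGI : Integrable (fun ω => G ω * I n ω) μ := (hB.integrable_I n).bdd_mul
    (hG.mono (ℱ.le n)).aestronglyMeasurable (c := C) (ae_of_all _ hC)
  have hGq : Integrable (fun ω => G ω * q n ω) μ := (hB.integrable_q n).bdd_mul
    (hG.mono (ℱ.le n)).aestronglyMeasurable (c := C) (ae_of_all _ hC)
  have hpull : μ[G * I n | ℱ n] =ᵐ[μ] G * μ[I n | ℱ n] :=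
    condExp_mul_of_stronglyMeasurable_left hG hGI (hB.integrable_I n)
  have key : ∫ ω, G ω * I n ω ∂μ = ∫ ω, G ω * q n ω ∂μ := by
    rw [← integral_condExp (ℱ.le n) (f := fun ω => G ω * I n ω)]
    refine integral_congr_ae ?_
    filter_upwards [hpull, hB.condExp_I n] with ω h1 h2
    change (μ[G * I n | ℱ n]) ω = _
    rw [h1, Pi.mul_apply, h2]
  simp_rw [mul_sub]
  rw [integral_sub hGI hGq, key, sub_self]

lemma ae_mul_sub_eq_zero (hB : IsBernoulliTransform μ ℱ I q h b) (n : ℕ) :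
    ∀ᵐ ω ∂μ, h n ω ^ 2 * q n ω * (1 - q n ω) = 0 → h n ω * (I n ω - q n ω) = 0 := by
  -- `|I - q|` vanishes almost surely where the conditional mean is `0` or `1`
  have h0 : ∀ᵐ ω ∂μ, q n ω = 0 → I n ω = 0 := by
    let G : Ω → ℝ := (q n ⁻¹' {0}).indicator 1
    have hGm : StronglyMeasurable[ℱ n] G := stronglyMeasurable_one.indicator
      ((hB.stronglyMeasurable_q n).measurable (measurableSet_singleton 0))
    have hGb : ∀ ω, |G ω| ≤ 1 := fun ω => by
      by_cases hω : q n ω = 0 <;> simp [G, hω]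
    have hz := hB.integral_mul_sub n hGm hGb
    rw [integral_eq_zero_iff_of_nonneg _ (hB.integrable_mul_sub n hGm hGb)] at hz
    · filter_upwards [hz] with ω hω hq
      simpa [G, Set.indicator, hq] using hω
    · intro ω
      by_cases hω : q n ω = 0
      · rcases hB.I_eq n ω with h | h <;> simp [G, hω, h]
      · simp [G, hω]
  have h1 : ∀ᵐ ω ∂μ, q n ω = 1 → I n ω = 1 := by
    let G : Ω → ℝ := (q n ⁻¹' {1}).indicator (fun _ => -1)
    have hGm : StronglyMeasurable[ℱ n] G := stronglyMeasurable_const.indicator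
      ((hB.stronglyMeasurable_q n).measurable (measurableSet_singleton 1))
    have hGb : ∀ ω, |G ω| ≤ 1 := fun ω => by
      by_cases hω : q n ω = 1 <;> simp [G, hω]
    have hz := hB.integral_mul_sub n hGm hGb
    rw [integral_eq_zero_iff_of_nonneg _ (hB.integrable_mul_sub n hGm hGb)] at hz
    · filter_upwards [hz] with ω hω hq
      have : 1 - I n ω = 0 := by simpa [G, Set.indicator, hq] using hω
      linarith
    · intro ω
      by_cases hω : q n ω = 1
      · rcases hB.I_eq n ω with h | h <;> simp [G, hω, h]
      · simp [G, hω]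
  filter_upwards [h0, h1] with ω h0 h1 hω
  rcases mul_eq_zero.1 hω with hω | hω
  · rcases mul_eq_zero.1 hω with hω | hω
    · rw [pow_eq_zero_iff two_ne_zero] at hω; simp [hω]
    · simp [hω, h0 hω]
  · have hq : q n ω = 1 := by linarith
    simp [hq, h1 hq]

lemma ae_transform_eq_zero (hB : IsBernoulliTransform μ ℱ I q h b) (n : ℕ) :
    ∀ᵐ ω ∂μ, bernoulliVariation q h n ω = 0 → bernoulliTransform I q h n ω = 0 := by
  filter_upwards [ae_all_iff.2 hB.ae_mul_sub_eq_zero] with ω hω hV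
  rw [bernoulliVariation,
    Finset.sum_eq_zero_iff_of_nonneg fun i _ => hB.variation_term_nonneg i ω] at hV
  exact Finset.sum_eq_zero fun i hi => hω i (hV i hi)

lemma integrable_exp (hB : IsBernoulliTransform μ ℱ I q h b) {l g : ℝ} (hl : 0 ≤ l)
    (hg : 0 ≤ g) (n : ℕ) : Integrable (fun ω =>
      Real.exp (l * bernoulliTransform I q h n ω - g * bernoulliVariation q h n ω)) μ :=
  integrable_of_bound ((hB.stronglyMeasurable_exp l g n).mono (ℱ.le n)) fun ω => by
    rw [Real.abs_exp]; exact hB.exp_le hl hg n ω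

lemma integral_exp_le_one (hB : IsBernoulliTransform μ ℱ I q h b) {l : ℝ} (hl : 0 ≤ l)
    (hlb : l * b < 3) {g : ℝ} (hg : g = l ^ 2 / (2 * (1 - l * b / 3))) (n : ℕ) :
    ∫ ω, Real.exp (l * bernoulliTransform I q h n ω - g * bernoulliVariation q h n ω) ∂μ
      ≤ 1 := by
  have hg0 : 0 ≤ g := by
    rw [hg]; exact div_nonneg (sq_nonneg _) (by linarith)
  induction n with
  | zero => simp [bernoulliTransform, bernoulliVariation]
  | succ n ih =>
    let G : Ω → ℝ := fun ω =>
      Real.exp (l * bernoulliTransform I q h n ω - g * bernoulliVariation q h (n + 1) ω)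
        * (l * h n ω + g * h n ω ^ 2 * (1 - 2 * q n ω))
    have hVm : StronglyMeasurable[ℱ n] (bernoulliVariation q h (n + 1)) := by
      have := (hB.stronglyMeasurable_variation n).add (hB.stronglyMeasurable_variation_term n)
      convert this using 1
      ext ω
      simp [bernoulliVariation, Finset.sum_range_succ]
    have hGm : StronglyMeasurable[ℱ n] G :=
      (Real.continuous_exp.comp_stronglyMeasurable
        (((hB.stronglyMeasurable_transform n).const_mul l).sub (hVm.const_mul g))).mul
        (((hB.stronglyMeasurable_h n).const_mul l).add
          ((((hB.stronglyMeasurable_h n).pow 2).const_mul g).mul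
            (stronglyMeasurable_const.sub ((hB.stronglyMeasurable_q n).const_mul 2))))
    have hGb : ∀ ω, |G ω| ≤ Real.exp (l * (n * b)) * (l * b + g * b ^ 2) := fun ω => by
      have hh := hB.abs_h_le n ω
      have hq0 := hB.q_nonneg n ω
      have hq1 := hB.q_le_one n ω
      have hh2 : h n ω ^ 2 ≤ b ^ 2 := sq_le_sq' (abs_le.1 hh).1 (abs_le.1 hh).2
      have h1 : |l * h n ω| ≤ l * b := by
        rw [abs_mul, abs_of_nonneg hl]; gcongr
      have h2 : |g * h n ω ^ 2 * (1 - 2 * q n ω)| ≤ g * b ^ 2 := by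
        rw [abs_mul, abs_of_nonneg (by positivity)]
        refine (mul_le_of_le_one_right (by positivity) ?_).trans (by gcongr)
        rw [abs_le]; constructor <;> linarith
      have h3 := mul_le_mul_of_nonneg_left (le_of_abs_le (hB.abs_transform_le n ω)) hl
      have h4 := mul_nonneg hg0 (hB.variation_nonneg (n + 1) ω)
      simp only [G]
      rw [abs_mul, Real.abs_exp]
      gcongr
      · linarith
      · exact (abs_add_le _ _).trans (add_le_add h1 h2)
    calc ∫ ω, Real.exp (l * bernoulliTransform I q h (n + 1) ω
            - g * bernoulliVariation q h (n + 1) ω) ∂μ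
        ≤ ∫ ω, (Real.exp (l * bernoulliTransform I q h n ω - g * bernoulliVariation q h n ω)
            + G ω * (I n ω - q n ω)) ∂μ :=
          integral_mono (hB.integrable_exp hl hg0 _)
            ((hB.integrable_exp hl hg0 n).add (hB.integrable_mul_sub n hGm hGb))
            (hB.exp_succ_le hl hlb hg n)
      _ = ∫ ω, Real.exp (l * bernoulliTransform I q h n ω
            - g * bernoulliVariation q h n ω) ∂μ := by
          rw [integral_add (hB.integrable_exp hl hg0 n) (hB.integrable_mul_sub n hGm hGb),
            hB.integral_mul_sub n hGm hGb, add_zero]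
      _ ≤ 1 := ih

lemma setIntegral_exp_le (hB : IsBernoulliTransform μ ℱ I q h b) {l : ℝ} (hl : 0 ≤ l)
    (hlb : l * b < 3) {g : ℝ} (hg : g = l ^ 2 / (2 * (1 - l * b / 3))) (n : ℕ) :
    ∫ ω in {ω | 0 < bernoulliVariation q h n ω},
        Real.exp (l * bernoulliTransform I q h n ω - g * bernoulliVariation q h n ω) ∂μ
      ≤ μ.real {ω | 0 < bernoulliVariation q h n ω} := by
  have hg0 : 0 ≤ g := by
    rw [hg]; exact div_nonneg (sq_nonneg _) (by linarith)
  set S := {ω | 0 < bernoulliVariation q h n ω} with hS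
  have hSm : MeasurableSet S := measurableSet_lt measurable_const
    ((hB.stronglyMeasurable_variation n).mono (ℱ.le n)).measurable
  have hcompl : ∫ ω in Sᶜ, Real.exp (l * bernoulliTransform I q h n ω
      - g * bernoulliVariation q h n ω) ∂μ = μ.real Sᶜ := by
    rw [setIntegral_congr_ae (g := fun _ => (1 : ℝ)) hSm.compl]
    · simp
    · filter_upwards [hB.ae_transform_eq_zero n] with ω hω hωS
      have hV : bernoulliVariation q h n ω = 0 :=
        le_antisymm (not_lt.1 hωS) (hB.variation_nonneg n ω)
      simp [hV, hω hV]
  have h1 := integral_add_compl hSm (hB.integrable_exp hl hg0 n)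
  have h2 := hB.integral_exp_le_one hl hlb hg n
  have h3 := probReal_add_probReal_compl (μ := μ) hSm
  linarith

/-- **Freedman's inequality** on the event that the quadratic variation is at most `y`. -/
lemma measureReal_le (hB : IsBernoulliTransform μ ℱ I q h b) (hb : 0 < b) {α y : ℝ}
    (hα : 0 < α) (hy : 0 < y) (n : ℕ) :
    μ.real {ω | Real.sqrt (2 * y * α) + α * b / 3 ≤ bernoulliTransform I q h n ω ∧
        0 < bernoulliVariation q h n ω ∧ bernoulliVariation q h n ω ≤ y}
      ≤ Real.exp (-α) * μ.real {ω | 0 < bernoulliVariation q h n ω} := by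
  let s := Real.sqrt (2 * α / y)
  have hs0 : 0 ≤ s := Real.sqrt_nonneg _
  have hs2 : s ^ 2 = 2 * α / y := Real.sq_sqrt (by positivity)
  have hα' : α = y * s ^ 2 / 2 := by rw [hs2]; field_simp
  have hsq : Real.sqrt (2 * y * α) = y * s := by
    rw [hα', ← Real.sqrt_sq (show 0 ≤ y * s by positivity)]
    congr 1; ring
  have hD : 0 < 1 + b / 3 * s := by positivity
  let l := s / (1 + b / 3 * s)
  have hl : 0 ≤ l := by positivity
  have hlb' : 1 - l * b / 3 = (1 + b / 3 * s)⁻¹ := by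
    simp only [l]; field_simp; ring
  have hlb : l * b < 3 := by
    have : 0 < 1 - l * b / 3 := by rw [hlb']; positivity
    linarith
  let g := l ^ 2 / (2 * (1 - l * b / 3))
  have hg0 : 0 ≤ g := div_nonneg (sq_nonneg _) (by linarith)
  have hopt : l * (y * s + α * b / 3) - g * y = α := by
    simp only [g]
    rw [hlb', hα']
    simp only [l]
    field_simp
    ring
  set S := {ω | 0 < bernoulliVariation q h n ω} with hS
  have hSm : MeasurableSet S := measurableSet_lt measurable_const
    ((hB.stronglyMeasurable_variation n).mono (ℱ.le n)).measurable
  let Z : Ω → ℝ := fun ω =>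
    Real.exp (l * bernoulliTransform I q h n ω - g * bernoulliVariation q h n ω)
  have hmarkov := mul_meas_ge_le_integral_of_nonneg (μ := μ) (f := S.indicator Z)
    (ae_of_all _ fun ω => Set.indicator_nonneg (fun _ _ => (Real.exp_pos _).le) ω)
    ((hB.integrable_exp hl hg0 n).indicator hSm) (Real.exp α)
  rw [integral_indicator hSm] at hmarkov
  have hle := hmarkov.trans (hB.setIntegral_exp_le hl hlb rfl n)
  rw [Real.exp_neg, ← div_eq_inv_mul, le_div_iff₀ (Real.exp_pos _), mul_comm]
  refine le_trans (mul_le_mul_of_nonneg_left (measureReal_mono ?_) (Real.exp_pos _).le) hle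
  rintro ω ⟨hM, hV0, hVy⟩
  have hωS : ω ∈ S := hV0
  simp only [Set.mem_ofPred_eq, Set.indicator_of_mem hωS, Z]
  refine Real.exp_le_exp.2 ?_
  rw [hsq] at hM
  have h1 := mul_le_mul_of_nonneg_left hM hl
  have h2 := mul_le_mul_of_nonneg_left hVy hg0
  linarith

end IsBernoulliTransform

/-- Geometric slices starting at `w` cover `[w, v]`. -/
lemma exists_geometric_slice {ε v w x : ℝ} (hε : 0 < ε) (hw : 0 < w) (hwx : w ≤ x)
    (hxv : x ≤ v) :
    ∃ k < ⌈Real.log (v / w + 1) / Real.log (1 + ε)⌉.toNat,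
      x ≤ w * (1 + ε) ^ (k + 1) ∧ w * (1 + ε) ^ (k + 1) ≤ (1 + ε) * x := by
  have h1 : 1 ≤ x / w := (one_le_div hw).2 hwx
  obtain ⟨k, hk1, hk2⟩ := exists_nat_pow_near h1 (show 1 < 1 + ε by linarith)
  rw [le_div_iff₀ hw] at hk1
  rw [div_lt_iff₀ hw] at hk2
  refine ⟨k, ?_, by linarith, ?_⟩
  · have hlog : 0 < Real.log (1 + ε) := Real.log_pos (by linarith)
    rw [Int.lt_toNat, Int.lt_ceil, lt_div_iff₀ hlog]
    push_cast
    rw [← Real.log_pow]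
    refine Real.log_lt_log (by positivity) ?_
    have : (1 + ε) ^ k ≤ v / w := by rw [le_div_iff₀ hw]; linarith
    linarith
  · rw [pow_succ]
    nlinarith

namespace IsBernoulliTransform

/-- Peeling version of Freedman's inequality. -/
lemma measureReal_peeling_le {Ω : Type*} {m0 : MeasurableSpace Ω} {μ : Measure Ω}
    [IsProbabilityMeasure μ] {ℱ : Filtration ℕ m0} {I q h : ℕ → Ω → ℝ} {b : ℝ}
    (hB : IsBernoulliTransform μ ℱ I q h b) (hb : 0 < b) {ε α v w : ℝ} (hε : 0 < ε)
    (hα : 0 < α) (hw : 0 < w) (n : ℕ) :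
    μ.real {ω | Real.sqrt (2 * α * (1 + ε) * bernoulliVariation q h n ω) + α * b / 3
          ≤ bernoulliTransform I q h n ω ∧
        w ≤ bernoulliVariation q h n ω ∧ bernoulliVariation q h n ω ≤ v}
      ≤ (⌈Real.log (v / w + 1) / Real.log (1 + ε)⌉.toNat : ℝ) * Real.exp (-α) *
        μ.real {ω | 0 < bernoulliVariation q h n ω} := by
  let E : ℕ → Set Ω := fun k =>
    {ω | Real.sqrt (2 * (w * (1 + ε) ^ (k + 1)) * α) + α * b / 3
        ≤ bernoulliTransform I q h n ω ∧ 0 < bernoulliVariation q h n ω ∧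
        bernoulliVariation q h n ω ≤ w * (1 + ε) ^ (k + 1)}
  set K := ⌈Real.log (v / w + 1) / Real.log (1 + ε)⌉.toNat with hK
  have hsub : {ω | Real.sqrt (2 * α * (1 + ε) * bernoulliVariation q h n ω) + α * b / 3
        ≤ bernoulliTransform I q h n ω ∧
      w ≤ bernoulliVariation q h n ω ∧ bernoulliVariation q h n ω ≤ v}
      ⊆ ⋃ k ∈ range K, E k := by
    rintro ω ⟨hM, hwV, hVv⟩
    obtain ⟨k, hk, hk1, hk2⟩ := exists_geometric_slice hε hw hwV hVv
    refine Set.mem_biUnion (Finset.mem_coe.2 (Finset.mem_range.2 hk)) ⟨?_, by linarith, hk1⟩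
    refine le_trans ?_ hM
    gcongr ?_ + _
    refine Real.sqrt_le_sqrt ?_
    nlinarith
  calc _ ≤ μ.real (⋃ k ∈ range K, E k) := measureReal_mono hsub (measure_ne_top μ _)
    _ ≤ ∑ k ∈ range K, μ.real (E k) := measureReal_biUnion_finset_le _ _
    _ ≤ ∑ k ∈ range K, Real.exp (-α) * μ.real {ω | 0 < bernoulliVariation q h n ω} :=
        Finset.sum_le_sum fun k _ => hB.measureReal_le hb hα (by positivity) n
    _ = _ := by rw [Finset.sum_const, Finset.card_range, nsmul_eq_mul, mul_assoc]

end IsBernoulliTransform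

/-- A function of finitely many finite-valued variables is measurable once the indicators of the
variables are. -/
lemma stronglyMeasurable_comp_of_indicators {Ω A : Type*} {m : MeasurableSpace Ω} [Fintype A]
    [DecidableEq A] {d : ℕ} (Y : Fin d → Ω → A)
    (hY : ∀ i a, StronglyMeasurable (fun ω => if Y i ω = a then (1 : ℝ) else 0))
    (f : (Fin d → A) → ℝ) : StronglyMeasurable fun ω => f fun i => Y i ω := by
  have : (fun ω => f fun i => Y i ω)
      = fun ω => ∑ x : Fin d → A, f x * ∏ i, if Y i ω = x i then (1 : ℝ) else 0 := by
    ext ω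
    rw [Finset.sum_eq_single fun i => Y i ω]
    · simp
    · intro x _ hx
      obtain ⟨i, hi⟩ := Function.ne_iff.1 hx
      rw [Finset.prod_eq_zero (Finset.mem_univ i) (if_neg hi.symm), mul_zero]
    · simp
  rw [this]
  exact Finset.stronglyMeasurable_fun_sum _ fun x _ =>
    (Finset.stronglyMeasurable_fun_prod _ fun i _ => hY i (x i)).const_mul _

/- Peeling version of the Freedman inequality: for `ε > 0`, `v > w > 0`, `α > 0`
and any `t`:
`P(M_t ≥ √(2α(1+ε)⟨M⟩_t) + αb/3, w ≤ ⟨M⟩_t ≤ v)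
  ≤ ⌈log(v/w + 1)/log(1+ε)⌉ e^{−α} P(⟨M⟩_t > 0)`. -/
theorem stmt15 {Ω : Type*} {m0 : MeasurableSpace Ω} (μ : Measure Ω)
    [IsProbabilityMeasure μ] (ℱ : Filtration ℕ m0)
    {A : Type*} [Fintype A] [DecidableEq A]
    (d : ℕ) (X : ℕ → Ω → A)
    (hX : ∀ t a, StronglyMeasurable[ℱ t] (fun ω => (if X t ω = a then (1 : ℝ) else 0)))
    (p : A → (Fin d → A) → ℝ)
    (hp01 : ∀ a x, 0 ≤ p a x ∧ p a x ≤ 1)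
    (hpsum : ∀ x, ∑ a, p a x = 1)
    (hMarkov : ∀ s, d ≤ s → ∀ a,
      μ[fun ω => (if X s ω = a then (1 : ℝ) else 0) | ℱ (s - 1)]
        =ᵐ[μ] fun ω => p a (fun i => X (s - d + i) ω))
    (b : ℝ) (hb : 0 < b) (H : ℕ → Ω → ℝ)
    (hHmeas : ∀ s, StronglyMeasurable[ℱ (s - 1)] (H s))
    (hHbdd : ∀ s ω, |H s ω| ≤ b)
    (hH0 : ∀ s ≤ d, ∀ ω, H s ω = 0)
    (a : A)
    (M : ℕ → Ω → ℝ)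
    (hM : ∀ t ω, M t ω = ∑ s ∈ Finset.range (t + 1),
      H s ω * ((if X s ω = a then (1 : ℝ) else 0) - p a (fun i => X (s - d + i) ω)))
    (QV : ℕ → Ω → ℝ)
    (hQV : ∀ t ω, QV t ω = ∑ s ∈ Finset.range (t + 1),
      H s ω ^ 2 * p a (fun i => X (s - d + i) ω) * (1 - p a (fun i => X (s - d + i) ω)))
    (ε α v w : ℝ) (hε : 0 < ε) (hα : 0 < α) (hw : 0 < w) (hvw : w < v) (t : ℕ) :
    μ {ω | Real.sqrt (2 * α * (1 + ε) * QV t ω) + α * b / 3 ≤ M t ω ∧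
          w ≤ QV t ω ∧ QV t ω ≤ v}
      ≤ ENNReal.ofReal
          (((⌈Real.log (v / w + 1) / Real.log (1 + ε)⌉ : ℤ) : ℝ) * Real.exp (-α)) *
        μ {ω | 0 < QV t ω} := by
  let I : ℕ → Ω → ℝ := fun n ω => if d ≤ n then (if X (n + 1) ω = a then 1 else 0) else 0
  let q : ℕ → Ω → ℝ := fun n ω => if d ≤ n then p a (fun i => X (n + 1 - d + i) ω) else 0
  let h : ℕ → Ω → ℝ := fun n => H (n + 1)
  have hB : IsBernoulliTransform μ ℱ I q h b := by
    refine ⟨fun n => ?_, fun n ω => ?_, fun n => ?_, fun n ω => ?_, fun n ω => ?_,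
      fun n => hHmeas (n + 1), fun n ω => hHbdd (n + 1) ω, fun n => ?_⟩ <;>
      by_cases hn : d ≤ n <;> simp only [I, q, hn, if_true, if_false]
    · exact hX (n + 1) a
    · exact stronglyMeasurable_const
    · split_ifs <;> simp
    · simp
    · exact stronglyMeasurable_comp_of_indicators _
        (fun i c => (hX _ c).mono (ℱ.mono (by omega))) (p a)
    · exact stronglyMeasurable_const
    · exact (hp01 a _).1
    · exact le_rfl
    · exact (hp01 a _).2
    · exact zero_le_one
    · exact hMarkov (n + 1) (by omega) a
    · rw [condExp_const (ℱ.le n)]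
  have hMeq : ∀ ω, M t ω = bernoulliTransform I q h t ω := fun ω => by
    rw [hM, Finset.sum_range_succ', hH0 0 (Nat.zero_le d), zero_mul, add_zero]
    refine Finset.sum_congr rfl fun n _ => ?_
    by_cases hn : d ≤ n
    · simp only [I, q, h, hn, if_true]
    · simp only [h, hH0 (n + 1) (by omega), zero_mul]
  have hVeq : ∀ ω, QV t ω = bernoulliVariation q h t ω := fun ω => by
    rw [hQV, Finset.sum_range_succ', hH0 0 (Nat.zero_le d)]
    simp only [ne_eq, OfNat.ofNat_ne_zero, not_false_eq_true, zero_pow, zero_mul, add_zero]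
    refine Finset.sum_congr rfl fun n _ => ?_
    by_cases hn : d ≤ n
    · simp only [q, h, hn, if_true]
    · simp [h, hH0 (n + 1) (by omega)]
  simp only [hMeq, hVeq]
  have hK : 0 ≤ ⌈Real.log (v / w + 1) / Real.log (1 + ε)⌉ := Int.ceil_nonneg <|
    div_nonneg (Real.log_nonneg (by have : 0 < v / w := div_pos (hw.trans hvw) hw; linarith))
      (Real.log_nonneg (by linarith))
  have hcast : ((⌈Real.log (v / w + 1) / Real.log (1 + ε)⌉.toNat : ℕ) : ℝ)
      = ((⌈Real.log (v / w + 1) / Real.log (1 + ε)⌉ : ℤ) : ℝ) := by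
    exact_mod_cast congrArg (Int.cast : ℤ → ℝ) (Int.toNat_of_nonneg hK)
  have hmain := hB.measureReal_peeling_le hb (v := v) hε hα hw t
  rw [hcast] at hmain
  rw [← ofReal_measureReal, ← ofReal_measureReal (s := {ω | 0 < _}),
    ← ENNReal.ofReal_mul (mul_nonneg (by exact_mod_cast hK) (Real.exp_pos _).le)]
  exact ENNReal.ofReal_le_ofReal hmain
end

section
/- KL divergence bound for single-lag binary MTDs: let p^{(j)}(1|x_{-d:-1}) = (1−λ)/2 + λ p(1|x_j) with δ = λ|p(1|1) − p(1|0)|. Then for stationary chains of order d with these kernels, KL(P^{(j)}_n ‖ P^{(k)}_n) ≤ 2nδ²/(1−λ) for all n > d and j, k ∈ ⟦-d,-1⟧. -/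
open Finset

/-- Value of a binary trajectory at an absolute time, `false` off range. -/
def getB {n : ℕ} (x : Fin n → Bool) (m : ℕ) : Bool :=
  if h : m < n then x ⟨m, h⟩ else false

/-- The length-`t` window of a binary trajectory starting at time `s`. -/
def window {n : ℕ} (s t : ℕ) (y : Fin n → Bool) : Fin t → Bool := fun i => getB y (s + i)

/-- The marginal of `q` on the times `s, …, s + t - 1`. -/
def windowMarginal {n : ℕ} (q : (Fin n → Bool) → ℝ) (s t : ℕ) (v : Fin t → Bool) : ℝ :=
  ∑ y with window s t y = v, q y

/-- Extend a binary word by one letter. -/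
def extend {t : ℕ} (v : Fin t → Bool) (b : Bool) : Fin (t + 1) → Bool :=
  Fin.snoc (α := fun _ => Bool) v b

theorem getB_extend_of_lt {t : ℕ} (v : Fin t → Bool) (b : Bool) {i : ℕ} (hi : i < t) :
    getB (extend v b) i = getB v i := by
  simp [getB, extend, Fin.snoc, hi, Nat.lt_succ_of_lt hi]

theorem getB_extend_self {t : ℕ} (v : Fin t → Bool) (b : Bool) :
    getB (extend v b) t = b := by
  simp [getB, extend, Fin.snoc]

theorem window_extend {t : ℕ} (v : Fin t → Bool) (b : Bool) {s r : ℕ} (h : s + r ≤ t) :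
    window s r (extend v b) = window s r v := by
  funext i
  exact getB_extend_of_lt v b (by omega)

theorem window_self {n : ℕ} (x : Fin n → Bool) : window 0 n x = x := by
  funext i
  simp [window, getB]

theorem window_eq_extend_iff {n s t : ℕ} (y : Fin n → Bool) (v : Fin t → Bool) (b : Bool) :
    window s (t + 1) y = extend v b ↔ window s t y = v ∧ getB y (s + t) = b := by
  constructor
  · intro h
    refine ⟨?_, ?_⟩
    · funext i
      have := congrFun h i.castSucc
      simpa [window, extend] using this
    · have := congrFun h (Fin.last t)
      simpa [window, extend] using this
  · rintro ⟨h, h'⟩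
    funext i
    refine Fin.lastCases ?_ (fun i => ?_) i
    · simpa [window, extend] using h'
    · simpa [window, extend] using congrFun h i

theorem sum_extend {t : ℕ} (f : (Fin (t + 1) → Bool) → ℝ) :
    ∑ x, f x = ∑ v, (f (extend v true) + f (extend v false)) := by
  rw [← (Fin.snocEquiv (fun _ : Fin (t + 1) => Bool)).sum_comp, Fintype.sum_prod_type_right]
  simp [extend, Fin.snocEquiv]

theorem sum_mul_window {n : ℕ} (q : (Fin n → Bool) → ℝ) (s t : ℕ) (f : (Fin t → Bool) → ℝ) :
    ∑ y, q y * f (window s t y) = ∑ w, windowMarginal q s t w * f w := by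
  rw [← Finset.sum_fiberwise (g := window s t)]
  refine Finset.sum_congr rfl fun w _ => ?_
  rw [windowMarginal, Finset.sum_mul]
  refine Finset.sum_congr rfl fun y hy => ?_
  rw [(Finset.mem_filter.1 hy).2]

theorem windowMarginal_succ {n : ℕ} (q : (Fin n → Bool) → ℝ) (s t : ℕ) (v : Fin t → Bool) :
    windowMarginal q s t v =
      windowMarginal q s (t + 1) (extend v true) + windowMarginal q s (t + 1) (extend v false) := by
  simp only [windowMarginal, window_eq_extend_iff, Finset.sum_filter]
  rw [← Finset.sum_add_distrib]
  refine Finset.sum_congr rfl fun y _ => ?_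
  by_cases h : window s t y = v <;> cases getB y (s + t) <;> simp [h]

theorem windowMarginal_self {n : ℕ} (q : (Fin n → Bool) → ℝ) (x : Fin n → Bool) :
    windowMarginal q 0 n x = q x := by
  simp [windowMarginal, window_self, Finset.sum_filter]

theorem windowMarginal_pos {n t : ℕ} (ht : t ≤ n) {q : (Fin n → Bool) → ℝ}
    (hq : ∀ x, 0 < q x) (v : Fin t → Bool) : 0 < windowMarginal q 0 t v := by
  refine Finset.sum_pos (fun y _ => hq y) ⟨fun i => getB v i, ?_⟩
  simp only [Finset.mem_filter, Finset.mem_univ, true_and]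
  funext i
  simp [window, getB, i.2, i.2.trans_le ht]

/-- The initial marginals of a Markov chain of order `d` factor through its kernel. -/
theorem windowMarginal_eq_mul_prod {n d : ℕ} {κ : (Fin d → Bool) → ℝ} {q : (Fin n → Bool) → ℝ}
    (hfac : ∀ x, q x = windowMarginal q 0 d (window 0 d x) *
      ∏ t ∈ Finset.Ico d n,
        (if getB x t then κ (window (t - d) d x) else 1 - κ (window (t - d) d x)))
    {T : ℕ} (hdT : d ≤ T) (hTn : T ≤ n) (v : Fin T → Bool) :
    windowMarginal q 0 T v = windowMarginal q 0 d (window 0 d v) *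
      ∏ t ∈ Finset.Ico d T,
        (if getB v t then κ (window (t - d) d v) else 1 - κ (window (t - d) d v)) := by
  induction hTn using Nat.decreasingInduction with
  | self => rw [windowMarginal_self, hfac v]
  | of_succ T hT ih =>
    have key : ∀ b, windowMarginal q 0 (T + 1) (extend v b) =
        (windowMarginal q 0 d (window 0 d v) * ∏ t ∈ Finset.Ico d T,
          (if getB v t then κ (window (t - d) d v) else 1 - κ (window (t - d) d v))) *
          (if b then κ (window (T - d) d v) else 1 - κ (window (T - d) d v)) := by
      intro b
      rw [ih (by omega), Finset.prod_Ico_succ_top hdT, ← mul_assoc, window_extend _ _ (by omega),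
        window_extend _ _ (by omega), getB_extend_self]
      congr 2
      refine Finset.prod_congr rfl fun t ht => ?_
      have := Finset.mem_Ico.1 ht
      rw [getB_extend_of_lt _ _ this.2, window_extend _ _ (by omega)]
    rw [windowMarginal_succ, key, key]
    simp only [if_true, Bool.false_eq_true, if_false]
    ring

theorem windowMarginal_extend_true {n d : ℕ} {κ : (Fin d → Bool) → ℝ} {q : (Fin n → Bool) → ℝ}
    (hfac : ∀ x, q x = windowMarginal q 0 d (window 0 d x) *
      ∏ t ∈ Finset.Ico d n,
        (if getB x t then κ (window (t - d) d x) else 1 - κ (window (t - d) d x)))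
    {T : ℕ} (hdT : d ≤ T) (hTn : T < n) (v : Fin T → Bool) :
    windowMarginal q 0 (T + 1) (extend v true) =
      windowMarginal q 0 T v * κ (window (T - d) d v) := by
  rw [windowMarginal_eq_mul_prod hfac hdT hTn.le, windowMarginal_eq_mul_prod hfac (by omega) hTn,
    Finset.prod_Ico_succ_top hdT, ← mul_assoc, window_extend _ _ (by omega),
    window_extend _ _ (by omega), getB_extend_self]
  congr 2
  refine Finset.prod_congr rfl fun t ht => ?_
  have := Finset.mem_Ico.1 ht
  rw [getB_extend_of_lt _ _ this.2, window_extend _ _ (by omega)]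

/-- If the `d`-windows at times `0` and `1` have the same law, so do all shorter windows
contained in the first `d + 1` times. -/
theorem windowMarginal_eq_of_stationary {n d : ℕ} {q : (Fin n → Bool) → ℝ}
    (hstat : ∀ v, windowMarginal q 1 d v = windowMarginal q 0 d v)
    (s t : ℕ) (hst : s + t ≤ d + 1) (v : Fin t → Bool) :
    windowMarginal q s t v = windowMarginal q 0 t v := by
  induction s with
  | zero => rfl
  | succ s ih =>
    rw [← ih (by omega)]
    have key : ∀ r, windowMarginal q (r + s) t v =
        ∑ w : Fin d → Bool, windowMarginal q r d w * if window s t w = v then 1 else 0 := by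
      intro r
      rw [← sum_mul_window q r d (fun w => if window s t w = v then 1 else 0),
        windowMarginal, Finset.sum_filter]
      refine Finset.sum_congr rfl fun y _ => ?_
      have : window s t (window r d y) = window (r + s) t y := by
        funext i
        have hi : s + i < d := by omega
        simp [window, getB, hi, add_assoc]
      simp [this]
    rw [add_comm s 1, key 1]
    simp only [hstat]
    rw [← key 0, zero_add]

/-- The conditional probabilities of a stationary chain given any initial segment lie between
the bounds of its kernel. -/
theorem windowMarginal_extend_mem {n d : ℕ} (hdn : d < n) {κ : (Fin d → Bool) → ℝ}
    {q : (Fin n → Bool) → ℝ} {m M : ℝ} (hκ : ∀ w, m ≤ κ w ∧ κ w ≤ M) (hq : ∀ x, 0 < q x)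
    (hfac : ∀ x, q x = windowMarginal q 0 d (window 0 d x) *
      ∏ t ∈ Finset.Ico d n,
        (if getB x t then κ (window (t - d) d x) else 1 - κ (window (t - d) d x)))
    (hstat : ∀ v, windowMarginal q 1 d v = windowMarginal q 0 d v)
    {T : ℕ} (hTn : T < n) (v : Fin T → Bool) :
    windowMarginal q 0 T v * m ≤ windowMarginal q 0 (T + 1) (extend v true) ∧
      windowMarginal q 0 (T + 1) (extend v true) ≤ windowMarginal q 0 T v * M := by
  rcases le_or_gt d T with hdT | hTd
  · rw [windowMarginal_extend_true hfac hdT hTn]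
    have := windowMarginal_pos hTn.le hq v
    exact ⟨mul_le_mul_of_nonneg_left (hκ _).1 this.le, mul_le_mul_of_nonneg_left (hκ _).2 this.le⟩
  · have hsub : ∀ y : Fin n → Bool, window (d - T) T (window 0 d y) = window (d - T) T y := by
      intro y
      funext i
      have hi : d - T + i < d := by omega
      simp [window, getB, hi]
    have h0 : windowMarginal q 0 T v =
        ∑ w : Fin d → Bool, windowMarginal q 0 d w *
          if window (d - T) T w = v then 1 else 0 := by
      rw [← windowMarginal_eq_of_stationary hstat (d - T) T (by omega),
        ← sum_mul_window q 0 d (fun w => if window (d - T) T w = v then 1 else 0),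
        windowMarginal, Finset.sum_filter]
      refine Finset.sum_congr rfl fun y _ => ?_
      simp [hsub]
    have h1 : windowMarginal q 0 (T + 1) (extend v true) =
        ∑ w : Fin d → Bool, windowMarginal q 0 d w * κ w *
          if window (d - T) T w = v then 1 else 0 := by
      have hκ' : ∀ w : Fin d → Bool, windowMarginal q 0 d w * κ w =
          windowMarginal q 0 (d + 1) (extend w true) := by
        intro w
        rw [windowMarginal_extend_true hfac le_rfl hdn, Nat.sub_self, window_self]
      simp only [hκ']
      rw [← windowMarginal_eq_of_stationary hstat (d - T) (T + 1) (by omega)]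
      trans ∑ u : Fin (d + 1) → Bool, windowMarginal q 0 (d + 1) u *
        if window (d - T) T u = v ∧ getB u d = true then 1 else 0
      · rw [← sum_mul_window q 0 (d + 1)
          (fun u => if window (d - T) T u = v ∧ getB u d = true then 1 else 0),
          windowMarginal, Finset.sum_filter]
        refine Finset.sum_congr rfl fun y _ => ?_
        have hw : window (d - T) T (window 0 (d + 1) y) = window (d - T) T y := by
          funext i
          have hi : d - T + i < d + 1 := by omega
          simp [window, getB, hi]
        have hg : getB (window 0 (d + 1) y) d = getB y d := by
          simp [window, getB]
        rw [hw, hg]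
        have hd : d - T + T = d := by omega
        simp only [window_eq_extend_iff, hd, mul_ite, mul_one, mul_zero]
      · rw [sum_extend]
        refine Finset.sum_congr rfl fun w _ => ?_
        rw [window_extend _ _ (by omega), window_extend _ _ (by omega), getB_extend_self,
          getB_extend_self]
        simp
    rw [h0, h1, Finset.sum_mul, Finset.sum_mul]
    constructor <;>
    · refine Finset.sum_le_sum fun w _ => ?_
      have := windowMarginal_pos hdn.le hq w
      have := hκ w
      split_ifs <;> simp <;> nlinarith

/-- A quadratic upper bound on the Kullback–Leibler divergence between two Bernoulli laws whose
parameters stay at distance at least `L` from `0` and `1`. -/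
theorem bernoulli_kl_le {L p q : ℝ} (hL : 0 < L) (hp : L ≤ p ∧ p ≤ 1 - L)
    (hq : L ≤ q ∧ q ≤ 1 - L) :
    p * (Real.log p - Real.log q) + (1 - p) * (Real.log (1 - p) - Real.log (1 - q)) ≤
      (p - q) ^ 2 / L := by
  set g : ℝ → ℝ := fun r => (p - r) ^ 2 / L -
    (p * (Real.log p - Real.log r) + (1 - p) * (Real.log (1 - p) - Real.log (1 - r))) with hg
  have hgp : g p = 0 := by simp [hg]
  have hderiv : ∀ r, 0 < r → r < 1 →
      HasDerivAt g ((r - p) * (2 / L - 1 / (r * (1 - r)))) r := by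
    intro r h0 h1
    have h1' : 0 < 1 - r := by linarith
    have hlog := (Real.hasDerivAt_log h0.ne').const_sub (Real.log p)
    have hlog' := ((((hasDerivAt_id r).const_sub 1).log h1'.ne').const_sub (Real.log (1 - p)))
    have hsq := (((hasDerivAt_id r).const_sub p).pow 2).div_const L
    refine (hsq.sub ((hlog.const_mul p).add (hlog'.const_mul (1 - p)))).congr_deriv ?_
    simp only [id]
    field_simp
    ring
  have hfactor : ∀ r, L ≤ r → r ≤ 1 - L → 0 ≤ 2 / L - 1 / (r * (1 - r)) := by
    intro r h0 h1
    have hr : 0 < r * (1 - r) := mul_pos (by linarith) (by linarith)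
    rw [sub_nonneg, div_le_div_iff₀ hr hL]
    nlinarith [mul_nonneg (sub_nonneg.2 h0) (sub_nonneg.2 h1)]
  have hcont : ∀ a b, L ≤ a → b ≤ 1 - L → ContinuousOn g (Set.Icc a b) := fun a b ha hb r hr =>
    (hderiv r (by linarith [hr.1]) (by linarith [hr.2])).continuousAt.continuousWithinAt
  suffices 0 ≤ g q by simp only [hg] at this; linarith
  rw [← hgp]
  rcases le_total p q with h | h
  · refine monotoneOn_of_hasDerivWithinAt_nonneg (convex_Icc p q) (hcont p q hp.1 hq.2)
      (f' := fun r => (r - p) * (2 / L - 1 / (r * (1 - r)))) ?_ ?_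
      (Set.left_mem_Icc.2 h) (Set.right_mem_Icc.2 h) h
    · intro r hr
      rw [interior_Icc] at hr
      exact (hderiv r (by linarith [hr.1]) (by linarith [hr.2])).hasDerivWithinAt
    · intro r hr
      rw [interior_Icc] at hr
      exact mul_nonneg (by linarith [hr.1]) (hfactor r (by linarith [hr.1]) (by linarith [hr.2]))
  · refine antitoneOn_of_hasDerivWithinAt_nonpos (convex_Icc q p) (hcont q p hq.1 hp.2)
      (f' := fun r => (r - p) * (2 / L - 1 / (r * (1 - r)))) ?_ ?_
      (Set.left_mem_Icc.2 h) (Set.right_mem_Icc.2 h) h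
    · intro r hr
      rw [interior_Icc] at hr
      exact (hderiv r (by linarith [hr.1]) (by linarith [hr.2])).hasDerivWithinAt
    · intro r hr
      rw [interior_Icc] at hr
      exact mul_nonpos_of_nonpos_of_nonneg (by linarith [hr.2])
        (hfactor r (by linarith [hr.1]) (by linarith [hr.2]))

/-- One step of the chain rule for the Kullback–Leibler divergence of binary sequences, with
both conditional probabilities in `[m, M]`. -/
theorem mul_log_add_mul_log_le {L m M a b a' b' : ℝ} (hL : 0 < L) (hm : L ≤ m) (hM : M ≤ 1 - L)
    (ha : 0 < a) (hb : 0 < b) (ha' : 0 < a') (hb' : 0 < b')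
    (h : (a + b) * m ≤ a ∧ a ≤ (a + b) * M) (h' : (a' + b') * m ≤ a' ∧ a' ≤ (a' + b') * M) :
    a * Real.log (a / a') + b * Real.log (b / b') ≤
      (a + b) * Real.log ((a + b) / (a' + b')) + (a + b) * ((M - m) ^ 2 / L) := by
  have hs : 0 < a + b := by positivity
  have hs' : 0 < a' + b' := by positivity
  have hp1 : m ≤ a / (a + b) := by rw [le_div_iff₀ hs]; linarith
  have hp2 : a / (a + b) ≤ M := by rw [div_le_iff₀ hs]; linarith
  have hq1 : m ≤ a' / (a' + b') := by rw [le_div_iff₀ hs']; linarith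
  have hq2 : a' / (a' + b') ≤ M := by rw [div_le_iff₀ hs']; linarith
  have hkl := bernoulli_kl_le hL (p := a / (a + b)) (q := a' / (a' + b'))
    ⟨by linarith, by linarith⟩ ⟨by linarith, by linarith⟩
  have hsq : (a / (a + b) - a' / (a' + b')) ^ 2 / L ≤ (M - m) ^ 2 / L := by
    refine div_le_div_of_nonneg_right (sq_le_sq' ?_ ?_) hL.le <;> linarith
  have e : 1 - a / (a + b) = b / (a + b) := by field_simp; ring
  have e' : 1 - a' / (a' + b') = b' / (a' + b') := by field_simp; ring
  rw [e, e', Real.log_div ha.ne' hs.ne', Real.log_div hb.ne' hs.ne', Real.log_div ha'.ne' hs'.ne',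
    Real.log_div hb'.ne' hs'.ne'] at hkl
  rw [Real.log_div ha.ne' ha'.ne', Real.log_div hb.ne' hb'.ne', Real.log_div hs.ne' hs'.ne']
  have := mul_le_mul_of_nonneg_left (hkl.trans hsq) hs.le
  have e2 : (a + b) * (a / (a + b)) = a := by field_simp
  have e3 : (a + b) * (b / (a + b)) = b := by field_simp
  rw [mul_add, ← mul_assoc, ← mul_assoc, e2, e3] at this
  linarith

/-- Two laws on binary sequences whose one-step conditional probabilities all lie in `[m, M]`
have Kullback–Leibler divergence at most `(M - m)² / L` per step. -/
theorem sum_windowMarginal_mul_log_le {n : ℕ} {q r : (Fin n → Bool) → ℝ} {L m M : ℝ}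
    (hL : 0 < L) (hm : L ≤ m) (hM : M ≤ 1 - L)
    (hq : ∀ x, 0 < q x) (hr : ∀ x, 0 < r x) (hqs : ∑ x, q x = 1) (hrs : ∑ x, r x = 1)
    (hqc : ∀ T < n, ∀ v : Fin T → Bool,
      windowMarginal q 0 T v * m ≤ windowMarginal q 0 (T + 1) (extend v true) ∧
        windowMarginal q 0 (T + 1) (extend v true) ≤ windowMarginal q 0 T v * M)
    (hrc : ∀ T < n, ∀ v : Fin T → Bool,
      windowMarginal r 0 T v * m ≤ windowMarginal r 0 (T + 1) (extend v true) ∧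
        windowMarginal r 0 (T + 1) (extend v true) ≤ windowMarginal r 0 T v * M)
    (T : ℕ) (hT : T ≤ n) :
    ∑ v : Fin T → Bool, windowMarginal q 0 T v *
      Real.log (windowMarginal q 0 T v / windowMarginal r 0 T v) ≤ T * ((M - m) ^ 2 / L) := by
  induction T with
  | zero =>
    have hz : ∀ (f : (Fin n → Bool) → ℝ) v, windowMarginal f 0 0 v = ∑ x, f x := fun f v => by
      rw [windowMarginal, Finset.filter_true_of_mem fun _ _ => Subsingleton.elim _ _]
    simp [hz, hqs, hrs]
  | succ T ih =>
    have hmass : ∑ v : Fin T → Bool, windowMarginal q 0 T v = 1 := by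
      simpa [hqs] using (sum_mul_window q 0 T fun _ => 1).symm
    rw [sum_extend]
    calc _ ≤ ∑ v : Fin T → Bool, (windowMarginal q 0 T v *
            Real.log (windowMarginal q 0 T v / windowMarginal r 0 T v) +
            windowMarginal q 0 T v * ((M - m) ^ 2 / L)) := by
          refine Finset.sum_le_sum fun v _ => ?_
          have h := hqc T hT v
          have h' := hrc T hT v
          rw [windowMarginal_succ q 0 T] at h ⊢
          rw [windowMarginal_succ r 0 T] at h' ⊢
          exact mul_log_add_mul_log_le hL hm hM (windowMarginal_pos hT hq _)
            (windowMarginal_pos hT hq _) (windowMarginal_pos hT hr _)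
            (windowMarginal_pos hT hr _) h h'
      _ ≤ T * ((M - m) ^ 2 / L) + (M - m) ^ 2 / L := by
          rw [Finset.sum_add_distrib, ← Finset.sum_mul, hmass, one_mul]
          linarith [ih (by omega)]
      _ = _ := by push_cast; ring

/- KL divergence bound for single-lag binary MTDs: with kernels
`p^{(j)}(1|x_{-d:-1}) = (1−λ)/2 + λ p(1|x_j)` and `δ = λ|p(1|1) − p(1|0)|`, the
laws `P^{(j)}_n`, `P^{(k)}_n` of the corresponding stationary chains of order `d`
satisfy `KL(P^{(j)}_n ‖ P^{(k)}_n) ≤ 2nδ²/(1−λ)` for all `n > d`.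
A trajectory law `q` is characterized by positivity, normalization, the Markov
factorization through the kernel, and stationarity of `d`-windows. -/
theorem stmt17 (n d : ℕ) (hdn : d < n)
    (lam : ℝ) (hlam : 0 < lam) (hlam1 : lam < 1)
    (pc : Bool → ℝ) (hpc : ∀ bb, 0 ≤ pc bb ∧ pc bb ≤ 1)
    (δ : ℝ) (hδ : δ = lam * |pc true - pc false|)
    -- single-lag kernels at lags `j` and `k`
    (j k : Fin d)
    (K : Fin d → (Fin d → Bool) → ℝ)
    (hK : ∀ l w, K l w = (1 - lam) / 2 + lam * pc (w l))
    -- the marginal laws on `X_{1:n}` of the stationary chains with these kernels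
    (qj qk : (Fin n → Bool) → ℝ)
    (hqjpos : ∀ x, 0 < qj x) (hqkpos : ∀ x, 0 < qk x)
    (hqjsum : ∑ x, qj x = 1) (hqksum : ∑ x, qk x = 1)
    (hfacj : ∀ x, qj x =
      (∑ y ∈ Finset.univ.filter (fun y => ∀ i < d, getB y i = getB x i), qj y) *
      ∏ t ∈ Finset.Ico d n,
        (if getB x t then K j (fun i => getB x (t - d + i))
          else 1 - K j (fun i => getB x (t - d + i))))
    (hfack : ∀ x, qk x =
      (∑ y ∈ Finset.univ.filter (fun y => ∀ i < d, getB y i = getB x i), qk y) *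
      ∏ t ∈ Finset.Ico d n,
        (if getB x t then K k (fun i => getB x (t - d + i))
          else 1 - K k (fun i => getB x (t - d + i))))
    (hstatj : ∀ t, t + d ≤ n → ∀ v : Fin d → Bool,
      (∑ x ∈ Finset.univ.filter (fun x => ∀ i : Fin d, getB x (t + i) = v i), qj x) =
      (∑ x ∈ Finset.univ.filter (fun x => ∀ i : Fin d, getB x i.val = v i), qj x))
    (hstatk : ∀ t, t + d ≤ n → ∀ v : Fin d → Bool,
      (∑ x ∈ Finset.univ.filter (fun x => ∀ i : Fin d, getB x (t + i) = v i), qk x) =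
      (∑ x ∈ Finset.univ.filter (fun x => ∀ i : Fin d, getB x i.val = v i), qk x)) :
    ∑ x, qj x * Real.log (qj x / qk x) ≤ 2 * n * δ ^ 2 / (1 - lam) := by
  have hfac' : ∀ (l : Fin d) (q : (Fin n → Bool) → ℝ), (∀ x, q x =
      (∑ y ∈ Finset.univ.filter (fun y => ∀ i < d, getB y i = getB x i), q y) *
      ∏ t ∈ Finset.Ico d n,
        (if getB x t then K l (fun i => getB x (t - d + i))
          else 1 - K l (fun i => getB x (t - d + i)))) →
      ∀ x, q x = windowMarginal q 0 d (window 0 d x) * ∏ t ∈ Finset.Ico d n,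
        (if getB x t then K l (window (t - d) d x) else 1 - K l (window (t - d) d x)) := by
    intro l q h x
    rw [h x]
    congr 1
    rw [windowMarginal]
    refine Finset.sum_congr (Finset.filter_congr fun y _ => ?_) fun _ _ => rfl
    simp only [funext_iff, window, zero_add]
    exact ⟨fun h i => h i i.2, fun h i hi => h ⟨i, hi⟩⟩
  have hstat' : ∀ q : (Fin n → Bool) → ℝ, (∀ t, t + d ≤ n → ∀ v : Fin d → Bool,
      (∑ x ∈ Finset.univ.filter (fun x => ∀ i : Fin d, getB x (t + i) = v i), q x) =
      (∑ x ∈ Finset.univ.filter (fun x => ∀ i : Fin d, getB x i.val = v i), q x)) →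
      ∀ v, windowMarginal q 1 d v = windowMarginal q 0 d v := by
    intro q h v
    have := h 1 (by omega) v
    simpa only [windowMarginal, funext_iff, window, zero_add] using this
  set m := (1 - lam) / 2 + lam * min (pc true) (pc false) with hm
  set M := (1 - lam) / 2 + lam * max (pc true) (pc false) with hM
  have hKmem : ∀ l w, m ≤ K l w ∧ K l w ≤ M := by
    intro l w
    have h1 : min (pc true) (pc false) ≤ pc (w l) := by cases w l <;> simp
    have h2 : pc (w l) ≤ max (pc true) (pc false) := by cases w l <;> simp
    rw [hK, hm, hM]
    constructor <;> gcongr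
  have hmL : (1 - lam) / 2 ≤ m :=
    le_add_of_nonneg_right (mul_nonneg hlam.le (le_min (hpc _).1 (hpc _).1))
  have hML : M ≤ 1 - (1 - lam) / 2 := by
    have : lam * max (pc true) (pc false) ≤ lam * 1 :=
      mul_le_mul_of_nonneg_left (max_le (hpc _).2 (hpc _).2) hlam.le
    linarith
  have hMm : (M - m) ^ 2 = δ ^ 2 := by
    rw [hδ, ← max_sub_min_eq_abs, max_comm, min_comm, hm, hM]
    ring
  have key := sum_windowMarginal_mul_log_le (L := (1 - lam) / 2) (by linarith) hmL hML
    hqjpos hqkpos hqjsum hqksum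
    (fun T hT v => windowMarginal_extend_mem hdn (hKmem j) hqjpos (hfac' j qj hfacj)
      (hstat' qj hstatj) hT v)
    (fun T hT v => windowMarginal_extend_mem hdn (hKmem k) hqkpos (hfac' k qk hfack)
      (hstat' qk hstatk) hT v) n le_rfl
  simp only [windowMarginal_self, hMm] at key
  refine key.trans_eq ?_
  have : 1 - lam ≠ 0 := by linarith
  field_simp
end
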